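/- arXiv:1807.06568 — 3 statements merged into one kernel-verified Lean document; each statement's English description precedes it below -/
import Mathlib

section
/- For every integer $n \ge 3$, the clutter $L_n = (V_n, E_n)$ with $V_n = \{1, \dots, n\}$ and $E_n = \{e_1, e_2\}$, where $e_1 = \{1, 3, 4, \dots, n\}$ and $e_2 = \{2, 3, 4, \dots, n\}$, is a clutter and has hardness $c(L_n) = \frac{1}{n-1} = \frac{1}{|V_n|-1}$. -/
/-- `E` is (the edge family of) a clutter: no edge is a subset of another edge. -/
def IsClutter {V : Type*} (E : Finset (Finset V)) : Prop :=
  ∀ e ∈ E, ∀ f ∈ E, e ⊆ f → e = f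

/-- `s` is a recognizing subset of the edge `e` of the clutter with edge family `E`:
`s ⊆ e` and the only edge containing `s` is `e` itself. -/
def Recognizing {V : Type*} (E : Finset (Finset V)) (e s : Finset V) : Prop :=
  s ⊆ e ∧ ∀ f ∈ E, s ⊆ f → f = e

/-- The hardness `c(e)` of an edge `e`: the ratio `|s_e|/|e|` where `s_e` is a smallest
recognizing subset of `e`. -/
noncomputable def edgeHardness {V : Type*} (E : Finset (Finset V)) (e : Finset V) : ℝ :=
  sInf {x : ℝ | ∃ s : Finset V, Recognizing E e s ∧ x = (s.card : ℝ) / (e.card : ℝ)}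

/-- The hardness `c(L)` of a clutter: the maximum hardness of its edges. -/
noncomputable def hardness {V : Type*} (E : Finset (Finset V)) : ℝ :=
  sSup {x : ℝ | ∃ e ∈ E, x = edgeHardness E e}

/-- An edge that has a vertex lying in no other edge, in a clutter with at least two edges,
has a singleton as a smallest recognizing subset. -/
theorem edgeHardness_eq_of_private_vertex {V : Type*} {E : Finset (Finset V)} {e f : Finset V}
    {a : V} (hf : f ∈ E) (hfe : f ≠ e) (ha : a ∈ e) (hE : ∀ g ∈ E, a ∈ g → g = e) :
    edgeHardness E e = 1 / (e.card : ℝ) := by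
  refine IsLeast.csInf_eq ⟨⟨{a}, ⟨by simpa using ha, fun g hg h => hE g hg (by simpa using h)⟩,
    by simp⟩, ?_⟩
  rintro x ⟨s, ⟨-, hs⟩, rfl⟩
  have hne : s.Nonempty := by
    rw [Finset.nonempty_iff_ne_empty]
    rintro rfl
    exact hfe (hs f hf (Finset.empty_subset f))
  have hcard : (1 : ℝ) ≤ s.card := by exact_mod_cast hne.card_pos
  gcongr

/-- If all edges have the same hardness, it is the hardness of the clutter. -/
theorem hardness_eq_of_forall {V : Type*} {E : Finset (Finset V)} {c : ℝ} (hE : E.Nonempty)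
    (h : ∀ e ∈ E, edgeHardness E e = c) : hardness E = c := by
  obtain ⟨e, he⟩ := hE
  refine IsGreatest.csSup_eq ⟨⟨e, he, (h e he).symm⟩, ?_⟩
  rintro x ⟨g, hg, rfl⟩
  exact (h g hg).le

/-- For `n ≥ 3`, the pair `(Vₙ, Eₙ)` with `Vₙ = {1,…,n}`,
`e₁ = {1,3,4,…,n}`, `e₂ = {2,3,4,…,n}` and `Eₙ = {e₁, e₂}` is a clutter with
hardness `1/(n-1) = 1/(|Vₙ|-1)`. -/
theorem statement1 (n : ℕ) (hn : 3 ≤ n) :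
    let Vn : Finset ℕ := Finset.Icc 1 n
    let e1 : Finset ℕ := insert 1 (Finset.Icc 3 n)
    let e2 : Finset ℕ := insert 2 (Finset.Icc 3 n)
    let En : Finset (Finset ℕ) := {e1, e2}
    IsClutter En ∧ e1 ⊆ Vn ∧ e2 ⊆ Vn ∧ Vn.card = n ∧
    hardness En = 1 / ((n : ℝ) - 1) ∧ hardness En = 1 / ((Vn.card : ℝ) - 1) := by
  intro Vn e1 e2 En
  have h11 : 1 ∈ e1 := by simp [e1]
  have h12 : 1 ∉ e2 := by simp [e2]
  have h21 : 2 ∉ e1 := by simp [e1]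
  have h22 : 2 ∈ e2 := by simp [e2]
  have hne : e1 ≠ e2 := fun h => h12 (h ▸ h11)
  have hmem : ∀ e ∈ En, e = e1 ∨ e = e2 := by simp [En]
  have hVn : Vn.card = n := by simp [Vn]
  have hc1 : (e1.card : ℝ) = n - 1 := by
    have : e1.card + 1 = n := by
      rw [Finset.card_insert_of_notMem (by simp), Nat.card_Icc]
      omega
    rw [← this]
    simp
  have hc2 : (e2.card : ℝ) = n - 1 := by
    have : e2.card + 1 = n := by
      rw [Finset.card_insert_of_notMem (by simp), Nat.card_Icc]
      omega
    rw [← this]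
    simp
  have hhard : hardness En = 1 / ((n : ℝ) - 1) := by
    refine hardness_eq_of_forall ⟨e1, by simp [En]⟩ fun e he => ?_
    rcases hmem e he with rfl | rfl
    · rw [← hc1]
      refine edgeHardness_eq_of_private_vertex (f := e2) (by simp [En]) hne.symm h11 ?_
      exact fun g hg h => (hmem g hg).resolve_right fun hg2 => h12 (hg2 ▸ h)
    · rw [← hc2]
      refine edgeHardness_eq_of_private_vertex (f := e1) (by simp [En]) hne h22 ?_
      exact fun g hg h => (hmem g hg).resolve_left fun hg1 => h21 (hg1 ▸ h)
  refine ⟨?_, ?_, ?_, hVn, hhard, by rw [hVn, hhard]⟩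
  · intro e he f hf hef
    rcases hmem e he with rfl | rfl <;> rcases hmem f hf with rfl | rfl
    · rfl
    · exact absurd (hef h11) h12
    · exact absurd (hef h22) h21
    · rfl
  · intro x hx
    simp only [e1, Vn, Finset.mem_insert, Finset.mem_Icc] at hx ⊢
    omega
  · intro x hx
    simp only [e2, Vn, Finset.mem_insert, Finset.mem_Icc] at hx ⊢
    omega
end

section
/- Let $L=(V,E)$ be a clutter with $|V| = n$ and $|E| = m \ge 2$ satisfying condition (C1) (no vertex of $L$ is present in all edges of $L$), in which every edge has a recognizing subset of size $1$. Then $c(L) \ge \frac{1}{n - (m + \frac{n}{m}) + 2}$, and in particular $n - (m + \frac{n}{m}) + 2 > 0$. -/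
theorem Recognizing.nonempty {V : Type*} {E : Finset (Finset V)} {e s : Finset V}
    (hE : 2 ≤ E.card) (h : Recognizing E e s) : s.Nonempty := by
  rw [Finset.nonempty_iff_ne_empty]
  rintro rfl
  obtain ⟨f, hf, hfe⟩ := Finset.exists_mem_ne hE e
  exact hfe (h.2 f hf (Finset.empty_subset f))

theorem edgeHardness_le_hardness {V : Type*} {E : Finset (Finset V)} {e : Finset V}
    (he : e ∈ E) : edgeHardness E e ≤ hardness E := by
  refine le_csSup (Set.Finite.bddAbove ?_) ⟨e, he, rfl⟩
  refine (E.finite_toSet.image (edgeHardness E)).subset ?_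
  rintro x ⟨f, hf, rfl⟩
  exact ⟨f, hf, rfl⟩

theorem one_div_card_le_edgeHardness {V : Type*} {E : Finset (Finset V)} {e : Finset V}
    (hE : 2 ≤ E.card) (hrec : ∃ s, Recognizing E e s) :
    1 / (e.card : ℝ) ≤ edgeHardness E e := by
  obtain ⟨s, hs⟩ := hrec
  refine le_csInf ⟨_, s, hs, rfl⟩ ?_
  rintro x ⟨t, ht, rfl⟩
  have : (1 : ℝ) ≤ t.card := by exact_mod_cast (ht.nonempty hE).card_pos
  gcongr

/-- If no vertex lies in all of the `k + 2` edges and every edge has a vertex of its own, then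
the sizes of the edges sum to at most `(k + 2) + (|V| - (k + 2)) * (k + 1)`. -/
theorem sum_card_edges_add_le {V : Type*} [Fintype V] (E : Finset (Finset V)) (k : ℕ)
    (hE : E.card = k + 2) (hC1 : ∀ v : V, ∃ e ∈ E, v ∉ e)
    (hrec : ∀ e ∈ E, ∃ v ∈ e, Recognizing E e {v}) :
    ∑ e ∈ E, e.card + (k + 2) * k ≤ Fintype.card V * (k + 1) := by
  classical
  obtain ⟨e₀, he₀⟩ : E.Nonempty := Finset.card_pos.1 (by omega)
  have : Nonempty V := ⟨(hrec e₀ he₀).choose⟩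
  choose! p hpe hp using hrec
  have hinj : Set.InjOn p E := fun e he f hf h =>
    (hp f hf).2 e he (Finset.singleton_subset_iff.2 (h ▸ hpe e he))
  have hcount : ∑ e ∈ E, e.card = ∑ v : V, (E.filter (v ∈ ·)).card := by
    refine Eq.trans (Finset.sum_congr rfl fun e _ => ?_)
      (Finset.sum_card_bipartiteAbove_eq_sum_card_bipartiteBelow
        (fun (e : Finset V) (v : V) => v ∈ e) (s := E) (t := Finset.univ))
    congr 1
    ext v
    simp [Finset.bipartiteAbove]
  have hprivate : (k + 2) * k = ∑ v : V, if v ∈ E.image p then k else 0 := by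
    rw [Finset.sum_ite_mem, Finset.univ_inter, Finset.sum_const, Finset.card_image_of_injOn hinj,
      hE, smul_eq_mul]
  rw [hcount, hprivate, ← Finset.sum_add_distrib, ← smul_eq_mul, ← Finset.card_univ]
  refine Finset.sum_le_card_nsmul _ _ _ fun v _ => ?_
  split_ifs with hv
  · obtain ⟨e, he, rfl⟩ := Finset.mem_image.1 hv
    have : (E.filter (p e ∈ ·)).card ≤ ({e} : Finset (Finset V)).card :=
      Finset.card_le_card fun f hf => by
        rw [Finset.mem_filter] at hf
        exact Finset.mem_singleton.2 ((hp e he).2 f hf.1 (Finset.singleton_subset_iff.2 hf.2))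
    rw [Finset.card_singleton] at this
    omega
  · obtain ⟨e, he, hve⟩ := hC1 v
    have : (E.filter (v ∈ ·)).card < E.card :=
      Finset.card_lt_card (Finset.filter_ssubset.2 ⟨e, he, hve⟩)
    omega

/-- A clutter on `n` vertices with `m ≥ 2` edges satisfying (C1), in which
every edge has a recognizing subset of size one, has hardness at least
`1/(n - (m + n/m) + 2)`; in particular `n - (m + n/m) + 2 > 0`. -/
theorem statement10 {V : Type*} [Fintype V] (E : Finset (Finset V)) (n m : ℕ)
    (hn : Fintype.card V = n) (hm : E.card = m) (hm2 : 2 ≤ m)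
    (hclutter : IsClutter E)
    (hC1 : ∀ v : V, ∃ e ∈ E, v ∉ e)
    (hrec : ∀ e ∈ E, ∃ v ∈ e, Recognizing E e {v}) :
    1 / ((n : ℝ) - ((m : ℝ) + (n : ℝ) / (m : ℝ)) + 2) ≤ hardness E ∧
    (0 : ℝ) < (n : ℝ) - ((m : ℝ) + (n : ℝ) / (m : ℝ)) + 2 := by
  obtain ⟨k, rfl⟩ := Nat.exists_eq_add_of_le' hm2
  have hsum := sum_card_edges_add_le E k hm hC1 hrec
  have hne : E.Nonempty := Finset.card_pos.1 (by omega)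
  obtain ⟨e, he, hmin⟩ := E.exists_min_image Finset.card hne
  obtain ⟨v, hve, hv⟩ := hrec e he
  have havg := E.card_nsmul_le_sum Finset.card e.card hmin
  rw [smul_eq_mul, hm] at havg
  have hcard : ((k : ℝ) + 2) * e.card + (k + 2) * k ≤ n * (k + 1) := by
    rw [hn] at hsum
    exact_mod_cast (Nat.add_le_add_right havg _).trans hsum
  have hpos : (0 : ℝ) < e.card := by exact_mod_cast Finset.card_pos.2 ⟨v, hve⟩
  have hk : (0 : ℝ) < k + 2 := by positivity
  have hle : (e.card : ℝ) ≤ n - (((k + 2 : ℕ) : ℝ) + n / ((k + 2 : ℕ) : ℝ)) + 2 := by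
    push_cast
    have : (n : ℝ) - ((k + 2) + n / (k + 2)) + 2 = (n * (k + 1) - (k + 2) * k) / (k + 2) := by
      field_simp
      ring
    rw [this, le_div_iff₀ hk]
    linarith
  refine ⟨?_, hpos.trans_le hle⟩
  calc 1 / ((n : ℝ) - (((k + 2 : ℕ) : ℝ) + n / ((k + 2 : ℕ) : ℝ)) + 2)
      ≤ 1 / (e.card : ℝ) := one_div_le_one_div_of_le hpos hle
    _ ≤ edgeHardness E e := one_div_card_le_edgeHardness (hm ▸ hm2) ⟨_, hv⟩
    _ ≤ hardness E := edgeHardness_le_hardness he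
end

section
/- For every integer $k \ge 2$ there exists a clutter $L = (V, E)$ with $|V| = n = k^2$ vertices satisfying conditions (C1) (no vertex is present in all edges) and (C2) (each vertex is present in at least one edge) such that $c(L) = \frac{1}{1 + (k-1)^2} = \frac{1}{n - 2\sqrt{n} + 2}$. Concretely, let $G$ be the graph obtained from a $k$-clique $Q$ by attaching to each vertex of $Q$ exactly $k-1$ pendant vertices from a set $U_0$ of $k(k-1)$ further vertices, and let $L$ be the clutter whose edges are the maximal independent sets of $G$ other than $U_0$; then every edge of $L$ has exactly $1 + (k-1)^2$ vertices, each edge has a recognizing subset consisting of a single vertex of $Q$, and $c(L) = \frac{1}{n - 2\sqrt{n} + 2}$. -/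
/-- `s` is a maximal independent set of the graph `G`: it is independent and not
contained in a larger independent set. -/
def IsMaxIndep {V : Type*} (G : SimpleGraph V) (s : Finset V) : Prop :=
  (∀ u ∈ s, ∀ v ∈ s, ¬ G.Adj u v) ∧
  ∀ t : Finset V, (∀ u ∈ t, ∀ v ∈ t, ¬ G.Adj u v) → s ⊆ t → s = t

/-- The corona of a clique on `ι`: each clique vertex `(i, none)` is joined to the pendant
vertices `(i, some a)` with `a : κ`. -/
def cliqueCorona (ι κ : Type*) : SimpleGraph (ι × Option κ) where
  Adj u v := u ≠ v ∧ (u.2 = none ∧ v.2 = none ∨ u.1 = v.1 ∧ (u.2 = none ∨ v.2 = none))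
  symm := ⟨by grind⟩
  loopless := ⟨by grind⟩

section Corona

variable {ι κ : Type*}

theorem cliqueCorona_adj {u v : ι × Option κ} : (cliqueCorona ι κ).Adj u v ↔
    u ≠ v ∧ (u.2 = none ∧ v.2 = none ∨ u.1 = v.1 ∧ (u.2 = none ∨ v.2 = none)) := Iff.rfl

instance [DecidableEq ι] [DecidableEq κ] : DecidableRel (cliqueCorona ι κ).Adj :=
  fun _ _ => decidable_of_iff' _ cliqueCorona_adj

variable [Fintype ι] [Fintype κ]

/-- The clique vertices of the corona. -/
def coronaClique (ι κ : Type*) [Fintype ι] [Fintype κ] : Finset (ι × Option κ) :=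
  {v | v.2 = none}

theorem mem_coronaClique {v : ι × Option κ} : v ∈ coronaClique ι κ ↔ v.2 = none := by
  simp [coronaClique]

theorem card_coronaClique : (coronaClique ι κ).card = Fintype.card ι := by
  have h : coronaClique ι κ = Finset.univ ×ˢ {none} := by
    ext ⟨i, o⟩; simp [mem_coronaClique, eq_comm]
  simp [h]

theorem not_adj_of_notMem_coronaClique {u v : ι × Option κ} (hu : u ∉ coronaClique ι κ)
    (hv : v ∉ coronaClique ι κ) : ¬ (cliqueCorona ι κ).Adj u v := by
  simp_all [mem_coronaClique, cliqueCorona_adj]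

variable [DecidableEq ι] [DecidableEq κ]

/-- The independent set consisting of the clique vertex `(i, none)` and all pendant vertices
not attached to it. -/
def coronaEdge (κ : Type*) {ι : Type*} [Fintype ι] [Fintype κ] [DecidableEq ι]
    [DecidableEq κ] (i : ι) : Finset (ι × Option κ) :=
  {v | v.2 = none ↔ v.1 = i}

theorem mem_coronaEdge {i : ι} {v : ι × Option κ} :
    v ∈ coronaEdge κ i ↔ (v.2 = none ↔ v.1 = i) := by
  simp [coronaEdge]

theorem none_mem_coronaEdge {i j : ι} : ((j, none) : ι × Option κ) ∈ coronaEdge κ i ↔ j = i := by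
  simp [mem_coronaEdge]

theorem coronaEdge_injective : Function.Injective (coronaEdge κ : ι → Finset (ι × Option κ)) :=
  fun _ _ h => none_mem_coronaEdge.1 (h ▸ none_mem_coronaEdge.2 rfl)

theorem card_coronaEdge (i : ι) :
    (coronaEdge κ i).card = 1 + (Fintype.card ι - 1) * Fintype.card κ := by
  have h : coronaEdge κ i = insert (i, none)
      (({i}ᶜ : Finset ι) ×ˢ Finset.univ.image (some : κ → Option κ)) := by
    ext ⟨j, _ | a⟩ <;> simp [mem_coronaEdge]
  rw [h, Finset.card_insert_of_notMem (by simp), Finset.card_product, Finset.card_compl,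
    Finset.card_image_of_injective _ (Option.some_injective κ)]
  simp [add_comm]

theorem card_filter_adj_compl_coronaClique
    {q : ι × Option κ} (hq : q ∈ coronaClique ι κ) :
    ((coronaClique ι κ)ᶜ.filter fun u => (cliqueCorona ι κ).Adj q u).card = Fintype.card κ := by
  obtain ⟨i, o⟩ := q
  obtain rfl : o = none := mem_coronaClique.1 hq
  have h : ((coronaClique ι κ)ᶜ.filter fun u => (cliqueCorona ι κ).Adj (i, none) u) =
      {i} ×ˢ Finset.univ.image (some : κ → Option κ) := by
    ext ⟨j, _ | a⟩ <;> simp [mem_coronaClique, cliqueCorona_adj, eq_comm]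
  rw [h, Finset.card_product, Finset.card_image_of_injective _ (Option.some_injective κ)]
  simp

theorem card_filter_adj_coronaClique
    {u : ι × Option κ} (hu : u ∉ coronaClique ι κ) :
    ((coronaClique ι κ).filter fun q => (cliqueCorona ι κ).Adj u q).card = 1 := by
  obtain ⟨i, _ | a⟩ := u
  · simp [mem_coronaClique] at hu
  refine Finset.card_eq_one.2 ⟨(i, none), ?_⟩
  ext ⟨j, _ | b⟩ <;> simp [mem_coronaClique, cliqueCorona_adj, eq_comm]

theorem isMaxIndep_compl_coronaClique [Nonempty κ] :
    IsMaxIndep (cliqueCorona ι κ) (coronaClique ι κ)ᶜ := by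
  refine ⟨fun u hu v hv => not_adj_of_notMem_coronaClique (by simpa using hu) (by simpa using hv),
    fun t ht hst => hst.antisymm ?_⟩
  rintro ⟨i, _ | a⟩ hv
  · have ha : (i, some (Classical.arbitrary κ)) ∈ t := hst (by simp [mem_coronaClique])
    exact (ht _ hv _ ha (by simp [cliqueCorona_adj])).elim
  · simp [mem_coronaClique]

theorem subset_coronaEdge {t : Finset (ι × Option κ)}
    (ht : ∀ u ∈ t, ∀ v ∈ t, ¬ (cliqueCorona ι κ).Adj u v) {i : ι} (hi : (i, none) ∈ t) :
    t ⊆ coronaEdge κ i := by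
  intro v hv
  have := ht _ hi _ hv
  obtain ⟨j, _ | a⟩ := v <;> simp_all [mem_coronaEdge, cliqueCorona_adj, eq_comm]

theorem isMaxIndep_coronaEdge (i : ι) : IsMaxIndep (cliqueCorona ι κ) (coronaEdge κ i) := by
  refine ⟨?_, fun t ht hst => hst.antisymm
    (subset_coronaEdge ht (hst (none_mem_coronaEdge.2 rfl)))⟩
  rintro ⟨j, _ | a⟩ hu ⟨l, _ | b⟩ hv <;> simp_all [mem_coronaEdge, cliqueCorona_adj, eq_comm]

theorem isMaxIndep_cliqueCorona_iff [Nonempty κ] {s : Finset (ι × Option κ)} :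
    IsMaxIndep (cliqueCorona ι κ) s ∧ s ≠ (coronaClique ι κ)ᶜ ↔ ∃ i, coronaEdge κ i = s := by
  constructor
  · rintro ⟨hs, hne⟩
    obtain ⟨i, hi⟩ : ∃ i, (i, none) ∈ s := by
      by_contra! h
      refine hne (hs.2 _ isMaxIndep_compl_coronaClique.1 ?_)
      rintro ⟨i, _ | a⟩ hv
      · exact (h i hv).elim
      · simp [mem_coronaClique]
    exact ⟨i, (hs.2 _ (isMaxIndep_coronaEdge i).1 (subset_coronaEdge hs.1 hi)).symm⟩
  · rintro ⟨i, rfl⟩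
    refine ⟨isMaxIndep_coronaEdge i, fun h => ?_⟩
    have hi : (i, none) ∈ coronaEdge κ i := none_mem_coronaEdge.2 rfl
    simp [h, mem_coronaClique] at hi

theorem recognizing_coronaEdge {E : Finset (Finset (ι × Option κ))}
    (hE : ∀ s ∈ E, ∃ i, coronaEdge κ i = s) (i : ι) :
    Recognizing E (coronaEdge κ i) {(i, none)} := by
  refine ⟨by simp [none_mem_coronaEdge], fun f hf hif => ?_⟩
  obtain ⟨j, rfl⟩ := hE f hf
  rw [Finset.singleton_subset_iff, none_mem_coronaEdge] at hif
  rw [hif]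

end Corona

/-- In a clutter with at least two edges, an edge with a one-vertex recognizing subset has
hardness the reciprocal of its size. -/
theorem edgeHardness_eq_of_recognizing_singleton {V : Type*} {E : Finset (Finset V)}
    (hE : E.Nontrivial) {e : Finset V} {v : V} (hv : Recognizing E e {v}) :
    edgeHardness E e = 1 / (e.card : ℝ) := by
  refine IsLeast.csInf_eq ⟨⟨{v}, hv, by simp⟩, ?_⟩
  rintro _ ⟨s, hs, rfl⟩
  obtain ⟨f, hf, hfe⟩ := hE.exists_ne e
  have hne : s.Nonempty := by
    rw [Finset.nonempty_iff_ne_empty]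
    rintro rfl
    exact hfe (hs.2 f hf (Finset.empty_subset f))
  gcongr
  exact_mod_cast hne.card_pos

/-- A clutter with at least two edges, all of size `n` and recognizable by a single vertex, has
hardness `1 / n`. -/
theorem hardness_eq_of_recognizing_singleton {V : Type*} {E : Finset (Finset V)}
    (hE : E.Nontrivial) {n : ℕ} (hn : ∀ e ∈ E, e.card = n)
    (hrec : ∀ e ∈ E, ∃ v, Recognizing E e {v}) : hardness E = 1 / (n : ℝ) := by
  have key : ∀ e ∈ E, edgeHardness E e = 1 / (n : ℝ) := fun e he => by
    obtain ⟨v, hv⟩ := hrec e he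
    rw [edgeHardness_eq_of_recognizing_singleton hE hv, hn e he]
  obtain ⟨e, he⟩ := hE.nonempty
  refine IsGreatest.csSup_eq ⟨⟨e, he, (key e he).symm⟩, ?_⟩
  rintro _ ⟨f, hf, rfl⟩
  exact (key f hf).le

/-- For every `k ≥ 2` there is a clutter on `n = k²` vertices satisfying
(C1) and (C2) with hardness exactly `1/(1+(k-1)²) = 1/(n - 2√n + 2)`: take the graph `G`
obtained from a `k`-clique `Q` by joining each vertex of `Q` to `k-1` pendant vertices
from a set `U₀` of `k(k-1)` further vertices, and let the edges of the clutter be the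
maximal independent sets of `G` other than `U₀`; every edge then has exactly
`1 + (k-1)²` vertices and has a recognizing subset consisting of a single vertex
of `Q`. -/
theorem statement11 (k : ℕ) (hk : 2 ≤ k) :
    ∃ (V : Type) (_ : Fintype V) (_ : DecidableEq V) (G : SimpleGraph V)
      (_ : DecidableRel G.Adj) (Q U₀ : Finset V) (E : Finset (Finset V)),
      Fintype.card V = k ^ 2 ∧
      -- `Q` is a `k`-clique
      Q.card = k ∧ G.IsClique (↑Q : Set V) ∧
      -- `U₀` consists of the remaining `k(k-1)` vertices
      U₀ = Qᶜ ∧ U₀.card = k * (k - 1) ∧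
      -- every vertex of `Q` is joined to exactly `k-1` vertices of `U₀`
      (∀ q ∈ Q, (U₀.filter fun u => G.Adj q u).card = k - 1) ∧
      -- every vertex of `U₀` is joined to exactly one vertex of `Q`
      (∀ u ∈ U₀, (Q.filter fun q => G.Adj u q).card = 1) ∧
      -- there are no edges inside `U₀`
      (∀ u ∈ U₀, ∀ v ∈ U₀, ¬ G.Adj u v) ∧
      -- `U₀` is a maximal independent set of `G`
      IsMaxIndep G U₀ ∧
      -- the edges of the clutter are the maximal independent sets of `G` other than `U₀`
      (∀ s : Finset V, s ∈ E ↔ IsMaxIndep G s ∧ s ≠ U₀) ∧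
      -- `(V, E)` is a clutter satisfying (C1) and (C2)
      IsClutter E ∧ (∀ v : V, ∃ e ∈ E, v ∉ e) ∧ (∀ v : V, ∃ e ∈ E, v ∈ e) ∧
      -- every edge has exactly `1 + (k-1)²` vertices
      (∀ e ∈ E, e.card = 1 + (k - 1) ^ 2) ∧
      -- every edge has a recognizing subset consisting of a single vertex of `Q`
      (∀ e ∈ E, ∃ q ∈ Q, Recognizing E e {q}) ∧
      hardness E = 1 / (1 + ((k : ℝ) - 1) ^ 2) ∧
      hardness E = 1 / (((k : ℝ) ^ 2) - 2 * Real.sqrt ((k : ℝ) ^ 2) + 2) := by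
  obtain ⟨m, rfl⟩ : ∃ m, k = m + 1 := ⟨k - 1, by omega⟩
  have : NeZero m := ⟨by omega⟩
  have : Nontrivial (Fin (m + 1)) := Fin.nontrivial_iff_two_le.2 hk
  set E : Finset (Finset (Fin (m + 1) × Option (Fin m))) :=
    Finset.univ.image (coronaEdge (Fin m)) with hE
  have mem_E : ∀ s, s ∈ E ↔ ∃ i, coronaEdge (Fin m) i = s := by simp [hE]
  have edge_mem : ∀ i, coronaEdge (Fin m) i ∈ E := fun i => (mem_E _).2 ⟨i, rfl⟩
  have hcard : ∀ e ∈ E, e.card = 1 + m ^ 2 := fun e he => by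
    obtain ⟨i, rfl⟩ := (mem_E e).1 he
    simp [card_coronaEdge, sq]
  have hrec : ∀ e ∈ E, ∃ q ∈ coronaClique (Fin (m + 1)) (Fin m), Recognizing E e {q} :=
    fun e he => by
      obtain ⟨i, rfl⟩ := (mem_E e).1 he
      exact ⟨(i, none), mem_coronaClique.2 rfl,
        recognizing_coronaEdge (fun s hs => (mem_E s).1 hs) i⟩
  have hnontriv : E.Nontrivial := by
    obtain ⟨i, j, hij⟩ := exists_pair_ne (Fin (m + 1))
    exact ⟨_, edge_mem i, _, edge_mem j, coronaEdge_injective.ne hij⟩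
  have hhard : hardness E = 1 / ((1 + m ^ 2 : ℕ) : ℝ) :=
    hardness_eq_of_recognizing_singleton hnontriv hcard fun e he =>
      (hrec e he).imp fun _ h => h.2
  have hQ : (coronaClique (Fin (m + 1)) (Fin m)).card = m + 1 := by simp [card_coronaClique]
  have hmax : ∀ s, s ∈ E ↔ IsMaxIndep (cliqueCorona (Fin (m + 1)) (Fin m)) s ∧
      s ≠ (coronaClique (Fin (m + 1)) (Fin m))ᶜ := fun s => by
    rw [mem_E, isMaxIndep_cliqueCorona_iff]
  refine ⟨Fin (m + 1) × Option (Fin m), inferInstance, inferInstance,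
    cliqueCorona (Fin (m + 1)) (Fin m), inferInstance, coronaClique _ _,
    (coronaClique _ _)ᶜ, E, by simp [sq], hQ, ?_, rfl, ?_, ?_, ?_, ?_,
    isMaxIndep_compl_coronaClique, hmax, ?_, ?_, ?_, hcard, hrec, ?_, ?_⟩
  · intro u hu v hv huv
    exact ⟨huv, .inl ⟨mem_coronaClique.1 hu, mem_coronaClique.1 hv⟩⟩
  · rw [Finset.card_compl, hQ]
    simp only [Fintype.card_prod, Fintype.card_option, Fintype.card_fin, Nat.add_sub_cancel]
    rw [Nat.mul_succ, Nat.add_sub_cancel]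
  · intro q hq
    simpa using card_filter_adj_compl_coronaClique hq
  · intro u hu
    exact card_filter_adj_coronaClique (by simpa using hu)
  · intro u hu v hv
    exact not_adj_of_notMem_coronaClique (by simpa using hu) (by simpa using hv)
  · intro e he f hf hef
    exact ((hmax e).1 he).1.2 f ((hmax f).1 hf).1.1 hef
  · rintro ⟨i, _ | a⟩
    · obtain ⟨j, hj⟩ := exists_ne i
      exact ⟨_, edge_mem j, by simpa [none_mem_coronaEdge] using hj.symm⟩
    · exact ⟨_, edge_mem i, by simp [mem_coronaEdge]⟩
  · rintro ⟨i, _ | a⟩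
    · exact ⟨_, edge_mem i, by simp [none_mem_coronaEdge]⟩
    · obtain ⟨j, hj⟩ := exists_ne i
      exact ⟨_, edge_mem j, by simpa [mem_coronaEdge] using hj.symm⟩
  · rw [hhard]
    push_cast
    ring
  · rw [hhard, Real.sqrt_sq (by positivity)]
    push_cast
    ring
end
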